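/- arXiv:0910.5851 — 2 statements merged into one kernel-verified Lean document; each statement's English description precedes it below -/
import Mathlib

section
/- Let N ≥ 1 and let F : ℝ^N → ℝ be positively 1-homogeneous and continuously differentiable on ℝ^N \ {0}. Then for every ε > 0 there exists R > 0 such that for every x with ‖x‖ ≥ R and every e with ‖e‖ ≤ 1, |F(x+e) − F(x) − ⟨∇F(x), e⟩| ≤ ε. -/
open scoped RealInnerProductSpace

/-- The derivative of a positively 1-homogeneous function is positively 0-homogeneous. -/
theorem fderiv_smul_of_posHomogeneous {E : Type*} [NormedAddCommGroup E] [NormedSpace ℝ E]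
    {F : E → ℝ} (hhom : ∀ α : ℝ, 0 < α → ∀ x, F (α • x) = α * F x) {α : ℝ} (hα : 0 < α) (x : E) :
    fderiv ℝ F (α • x) = fderiv ℝ F x := by
  have h : (fun y ↦ F (α • y)) = α • F := funext fun y ↦ hhom α hα y
  have h₂ : α • fderiv ℝ F (α • x) = α • fderiv ℝ F x := by
    rw [← fderiv_comp_smul, h, fderiv_const_smul_field, Pi.smul_apply]
  exact smul_right_injective _ hα.ne' h₂

/-- The derivative of a positively 1-homogeneous function that is `C^1` away from the origin
oscillates little on unit balls centred far from the origin. -/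
theorem exists_norm_fderiv_sub_le_of_posHomogeneous {E : Type*} [NormedAddCommGroup E]
    [NormedSpace ℝ E] [ProperSpace E] {F : E → ℝ}
    (hhom : ∀ α : ℝ, 0 < α → ∀ x, F (α • x) = α * F x) (hC1 : ContDiffOn ℝ 1 F {(0 : E)}ᶜ)
    {ε : ℝ} (hε : 0 < ε) :
    ∃ R : ℝ, 1 < R ∧ ∀ x w : E, R ≤ ‖x‖ → ‖w - x‖ ≤ 1 → ‖fderiv ℝ F w - fderiv ℝ F x‖ ≤ ε := by
  have hcont : ∀ a ∈ Metric.sphere (0 : E) 1, ContinuousAt (fderiv ℝ F) a := fun a ha ↦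
    (hC1.continuousOn_fderiv_of_isOpen isOpen_compl_singleton le_rfl).continuousAt
      (isOpen_compl_singleton.mem_nhds (ne_zero_of_mem_unit_sphere ⟨a, ha⟩))
  obtain ⟨δ, hδ, hunif⟩ := Metric.mem_uniformity_dist.1
    ((isCompact_sphere (0 : E) 1).uniformContinuousAt_of_continuousAt _ hcont
      (Metric.dist_mem_uniformity hε))
  refine ⟨1 + 1 / δ, by linarith [one_div_pos.2 hδ], fun x w hx hw ↦ ?_⟩
  have hr : 0 < ‖x‖ := by linarith [one_div_pos.2 hδ]
  have hrδ : 1 < δ * ‖x‖ := by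
    rw [mul_comm, ← div_lt_iff₀ hδ]
    linarith
  have hdist : dist (‖x‖⁻¹ • x) (‖x‖⁻¹ • w) < δ := by
    rw [dist_comm, dist_eq_norm, ← smul_sub, norm_smul, norm_inv, norm_norm, inv_mul_lt_iff₀ hr]
    linarith
  have hsphere : ‖x‖⁻¹ • x ∈ Metric.sphere (0 : E) 1 := by
    rw [mem_sphere_zero_iff_norm, norm_smul, norm_inv, norm_norm, inv_mul_cancel₀ hr.ne']
  have h : dist (fderiv ℝ F (‖x‖⁻¹ • x)) (fderiv ℝ F (‖x‖⁻¹ • w)) < ε := hunif hdist hsphere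
  rw [fderiv_smul_of_posHomogeneous hhom (inv_pos.2 hr),
    fderiv_smul_of_posHomogeneous hhom (inv_pos.2 hr), dist_comm, dist_eq_norm] at h
  exact h.le

theorem stmt8 (N : ℕ) (hN : 1 ≤ N)
    (F : EuclideanSpace ℝ (Fin N) → ℝ)
    (hhom : ∀ α : ℝ, 0 < α → ∀ x : EuclideanSpace ℝ (Fin N), F (α • x) = α * F x)
    (hC1 : ContDiffOn ℝ 1 F {(0 : EuclideanSpace ℝ (Fin N))}ᶜ) :
    ∀ ε : ℝ, 0 < ε → ∃ R : ℝ, 0 < R ∧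
      ∀ x e : EuclideanSpace ℝ (Fin N), R ≤ ‖x‖ → ‖e‖ ≤ 1 →
        |F (x + e) - F x - ⟪gradient F x, e⟫| ≤ ε := by
  intro ε hε
  obtain ⟨R, hR, hosc⟩ := exists_norm_fderiv_sub_le_of_posHomogeneous hhom hC1 hε
  refine ⟨R, by linarith, fun x e hx he ↦ ?_⟩
  have hdiff : ∀ w ∈ Metric.closedBall x 1, DifferentiableAt ℝ F w := by
    intro w hw
    have hw0 : w ≠ 0 := by
      rintro rfl
      rw [mem_closedBall_iff_norm, zero_sub, norm_neg] at hw
      linarith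
    exact (hC1.contDiffAt (isOpen_compl_singleton.mem_nhds hw0)).differentiableAt one_ne_zero
  have hmv := (convex_closedBall x 1).norm_image_sub_le_of_norm_hasFDerivWithin_le'
    (fun w hw ↦ (hdiff w hw).hasFDerivAt.hasFDerivWithinAt)
    (fun w hw ↦ hosc x w hx (mem_closedBall_iff_norm.1 hw))
    (Metric.mem_closedBall_self zero_le_one)
    (show x + e ∈ Metric.closedBall x 1 by simpa [mem_closedBall_iff_norm] using he)
  rw [add_sub_cancel_left, Real.norm_eq_abs] at hmv
  rw [gradient, InnerProductSpace.toDual_symm_apply]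
  exact hmv.trans (mul_le_of_le_one_right hε.le he)
end

section
/- Let v ∈ ℝ² with v ≠ 0, and let δ¹, δ² ∈ ℝ² be such that for all α ∈ [0,1] and all A ≥ 0, α·δ¹ + (1−α)·δ² ≠ A·v (that is, no convex combination of δ¹ and δ² lies on the closed ray {A·v : A ≥ 0}). Then there exists η ∈ ℝ² such that ⟨η, v⟩ > 0, ⟨η, δ¹⟩ < 0 and ⟨η, δ²⟩ < 0. -/
open scoped RealInnerProductSpace

/-- A compact segment disjoint from a closed ray is separated from it by a linear functional that
is negative on the endpoints of the segment and nonnegative on the ray. -/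
theorem exists_dual_neg_of_segment_disjoint_ray {E : Type*} [NormedAddCommGroup E]
    [NormedSpace ℝ E] {v x y : E}
    (h : Disjoint (segment ℝ x y) ((fun A : ℝ => A • v) '' Set.Ici 0)) :
    ∃ f : StrongDual ℝ E, 0 ≤ f v ∧ f x < 0 ∧ f y < 0 := by
  have hcompact : IsCompact (segment ℝ x y) := by
    rw [segment_eq_image]
    exact isCompact_Icc.image (by fun_prop)
  have hconvex : Convex ℝ ((fun A : ℝ => A • v) '' Set.Ici 0) :=
    (convex_Ici 0).is_linear_image (LinearMap.toSpanSingleton ℝ E v).isLinear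
  obtain ⟨f, u, w, hseg, huw, hray⟩ := geometric_hahn_banach_compact_closed
    (convex_segment x y) hcompact hconvex (isClosedMap_smul_left v _ isClosed_Ici) h
  have hw (A : ℝ) (hA : 0 ≤ A) : w < A * f v := by
    simpa using hray _ (Set.mem_image_of_mem _ hA)
  have hw0 : w < 0 := by simpa using hw 0 le_rfl
  refine ⟨f, ?_, (hseg x (left_mem_segment ℝ x y)).trans (huw.trans hw0),
    (hseg y (right_mem_segment ℝ x y)).trans (huw.trans hw0)⟩
  by_contra! hfv
  have := hw (w / f v) (div_nonneg_of_nonpos hw0.le hfv.le)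
  rw [div_mul_cancel₀ w hfv.ne] at this
  exact this.false

/-- Moving a vector slightly towards `v` makes its inner product with `v` positive while keeping
negative inner products negative. -/
theorem exists_inner_pos_of_inner_nonneg {E : Type*} [NormedAddCommGroup E]
    [InnerProductSpace ℝ E] {v x y η : E} (hv : v ≠ 0) (hηv : 0 ≤ ⟪η, v⟫) (hx : ⟪η, x⟫ < 0)
    (hy : ⟪η, y⟫ < 0) :
    ∃ ξ : E, 0 < ⟪ξ, v⟫ ∧ ⟪ξ, x⟫ < 0 ∧ ⟪ξ, y⟫ < 0 := by
  have hcont (z : E) (hz : ⟪η, z⟫ < 0) : ∀ᶠ ε : ℝ in nhds 0, ⟪η + ε • v, z⟫ < 0 :=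
    ContinuousAt.eventually_lt (by fun_prop) continuousAt_const (by simpa using hz)
  obtain ⟨ε, ⟨hεx, hεy⟩, hε⟩ :=
    ((((hcont x hx).and (hcont y hy)).filter_mono nhdsWithin_le_nhds).and
      (self_mem_nhdsWithin : Set.Ioi (0 : ℝ) ∈ nhdsWithin 0 (Set.Ioi 0))).exists
  refine ⟨η + ε • v, ?_, hεx, hεy⟩
  rw [inner_add_left, real_inner_smul_left]
  exact add_pos_of_nonneg_of_pos hηv (mul_pos hε (real_inner_self_pos.2 hv))

theorem stmt12 (v δ₁ δ₂ : EuclideanSpace ℝ (Fin 2)) (hv : v ≠ 0)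
    (h : ∀ α : ℝ, α ∈ Set.Icc (0 : ℝ) 1 → ∀ A : ℝ, 0 ≤ A →
        α • δ₁ + (1 - α) • δ₂ ≠ A • v) :
    ∃ η : EuclideanSpace ℝ (Fin 2),
      0 < ⟪η, v⟫ ∧ ⟪η, δ₁⟫ < 0 ∧ ⟪η, δ₂⟫ < 0 := by
  have hdisj : Disjoint (segment ℝ δ₁ δ₂) ((fun A : ℝ => A • v) '' Set.Ici 0) := by
    rw [Set.disjoint_left]
    rintro _ ⟨a, b, ha, hb, hab, rfl⟩ ⟨A, hA, hAv⟩
    obtain rfl : b = 1 - a := by linarith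
    exact h a ⟨ha, by linarith⟩ A hA hAv.symm
  obtain ⟨f, hfv, hf₁, hf₂⟩ := exists_dual_neg_of_segment_disjoint_ray hdisj
  rw [← InnerProductSpace.toDual_symm_apply] at hfv hf₁ hf₂
  exact exists_inner_pos_of_inner_nonneg hv hfv hf₁ hf₂
end
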